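/- Let O⊆ℂ be an open connected set, n≥1, R>0, and let P(t,τ,ξ)=τ³+a₁(t,ξ)τ²+a₂(t,ξ)τ+a₃(t,ξ), where each a_j(t,ξ) is a polynomial in ξ∈ℝⁿ whose coefficients are analytic functions of t∈O. Suppose that for each ξ∈ℝⁿ with |ξ|≥R there are analytic functions τ₁(·,ξ),τ₂(·,ξ),τ₃(·,ξ):O→ℂ such that P(t,τ,ξ)=(τ−τ₁(t,ξ))(τ−τ₂(t,ξ))(τ−τ₃(t,ξ)) for all t∈O and τ∈ℂ. Let Q(t,τ,σ,ξ) be a polynomial in (τ,σ,ξ), symmetric in the pair (τ,σ), whose coefficients are analytic functions of t∈O. Then for every compact set K⊆O there exists ν∈ℕ such that for every ξ∈ℝⁿ with |ξ|≥R and every pair (j,k)∈S2, the function t↦Q(t,τ_j(t,ξ),τ_k(t,ξ),ξ) is either identically zero on O or has at most ν zeros in K. -/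

import Mathlib

/-- `a(t,ξ)` is a polynomial in `ξ ∈ ℝⁿ` whose coefficients are analytic on `O ⊆ ℂ`. -/
def IsPolyXiAnalyticT (O : Set ℂ) (n : ℕ) (a : ℂ → EuclideanSpace ℝ (Fin n) → ℂ) : Prop :=
  ∃ (d : ℕ) (e : Fin d → Fin n → ℕ) (c : Fin d → ℂ → ℂ),
    (∀ i, DifferentiableOn ℂ (c i) O) ∧
    ∀ t ξ, a t ξ = ∑ i, c i t * ((∏ k, ξ k ^ e i k : ℝ) : ℂ)

/-- `Q(t,τ,σ,ξ)` is a polynomial in `(τ,σ,ξ)` whose coefficients are analytic on `O ⊆ ℂ`. -/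
def IsPolyTauSigmaXiAnalyticT (O : Set ℂ) (n : ℕ)
    (Q : ℂ → ℂ → ℂ → EuclideanSpace ℝ (Fin n) → ℂ) : Prop :=
  ∃ (d : ℕ) (p q : Fin d → ℕ) (e : Fin d → Fin n → ℕ) (c : Fin d → ℂ → ℂ),
    (∀ i, DifferentiableOn ℂ (c i) O) ∧
    ∀ t τ σ ξ, Q t τ σ ξ = ∑ i, c i t * τ ^ p i * σ ^ q i * ((∏ k, ξ k ^ e i k : ℝ) : ℂ)

open Metric Filter Topology MvPolynomial

/-- A holomorphic function on a disk of radius `4 * r` that has many zeros in the concentric disk of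
radius `r` is small on the latter. -/
theorem norm_le_pow_card_zeros_mul {O : Set ℂ} (hO : IsOpen O) {c : ℂ} {r : ℝ} (hr : 0 < r)
    (hball : closedBall c (4 * r) ⊆ O) (S : Finset ℂ) :
    ∀ (f : ℂ → ℂ) (M : ℝ), DifferentiableOn ℂ f O → (∀ z ∈ closedBall c (4 * r), ‖f z‖ ≤ M) →
      ↑S ⊆ closedBall c r → (∀ z ∈ S, f z = 0) →
      ∀ z ∈ closedBall c r, ‖f z‖ ≤ (2 / 3) ^ S.card * M := by
  induction S using Finset.induction_on with
  | empty =>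
    intro f M _ hM _ _ z hz
    simpa using hM z (closedBall_subset_closedBall (by linarith) hz)
  | insert a S ha ih =>
    intro f M hf hM hS hzero z hz
    have har : a ∈ closedBall c r := hS (by simp)
    have haO : a ∈ O := hball (closedBall_subset_closedBall (by linarith) har)
    have hfa : f a = 0 := hzero a (by simp)
    have hmul (w : ℂ) : (w - a) * dslope f a w = f w := by
      simpa [hfa] using sub_smul_dslope f a w
    have hg : DifferentiableOn ℂ (dslope f a) O :=
      (Complex.differentiableOn_dslope (hO.mem_nhds haO)).2 hf
    rw [mem_closedBall, dist_eq_norm] at har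
    have hgM : ∀ w ∈ closedBall c (4 * r), ‖dslope f a w‖ ≤ M / (3 * r) := by
      intro w hw
      have h4r : 4 * r ≠ 0 := by positivity
      refine Complex.norm_le_of_forall_mem_frontier_norm_le (U := ball c (4 * r)) isBounded_ball
        (hg.diffContOnCl_ball hball) ?_ (by rwa [closure_ball c h4r])
      intro u hu
      rw [frontier_ball c h4r, mem_sphere, dist_eq_norm] at hu
      have h1 : 3 * r ≤ ‖u - a‖ := by
        have h2 : ‖u - c‖ ≤ ‖u - a‖ + ‖a - c‖ := norm_sub_le_norm_sub_add_norm_sub u a c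
        linarith
      rw [le_div_iff₀ (by positivity)]
      calc ‖dslope f a u‖ * (3 * r) ≤ ‖dslope f a u‖ * ‖u - a‖ := by gcongr
        _ = ‖f u‖ := by rw [← hmul u, norm_mul, mul_comm]
        _ ≤ M := hM u (by simp [dist_eq_norm, hu])
    have hgz := ih (dslope f a) (M / (3 * r)) hg hgM
      (fun s hs => hS (by simp [Finset.mem_coe.1 hs])) (fun s hs => by
        have hsa : s - a ≠ 0 := sub_ne_zero.2 fun h => ha (h ▸ hs)
        have h0 := hmul s
        rw [hzero s (by simp [hs])] at h0
        exact (mul_eq_zero.1 h0).resolve_left hsa) z hz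
    have hza : ‖z - a‖ ≤ 2 * r := by
      rw [mem_closedBall, dist_eq_norm] at hz
      have h2 : ‖z - a‖ ≤ ‖z - c‖ + ‖c - a‖ := norm_sub_le_norm_sub_add_norm_sub z c a
      rw [norm_sub_rev c a] at h2
      linarith
    calc ‖f z‖ = ‖z - a‖ * ‖dslope f a z‖ := by rw [← hmul z, norm_mul]
      _ ≤ (2 * r) * ((2 / 3) ^ S.card * (M / (3 * r))) := by gcongr
      _ = (2 / 3) ^ (insert a S).card * M := by
        rw [Finset.card_insert_of_notMem ha, pow_succ]
        field_simp

/-- A linear map that vanishes on the kernel of another one is bounded by it, in finite dimension. -/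
theorem LinearMap.exists_norm_le_mul_norm_of_ker_le {V E F : Type*} [AddCommGroup V] [Module ℂ V]
    [FiniteDimensional ℂ V] [NormedAddCommGroup E] [NormedSpace ℂ E] [NormedAddCommGroup F]
    [NormedSpace ℂ F] (A : V →ₗ[ℂ] E) (B : V →ₗ[ℂ] F) (h : ker A ≤ ker B) :
    ∃ C : ℝ, 0 < C ∧ ∀ v, ‖B v‖ ≤ C * ‖A v‖ := by
  let G : range A →ₗ[ℂ] F := (ker A).liftQ B h ∘ₗ A.quotKerEquivRange.symm.toLinearMap
  have hG (v : V) : G (A.rangeRestrict v) = B v := by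
    have : A.quotKerEquivRange.symm (A.rangeRestrict v) = (ker A).mkQ v := by
      rw [LinearEquiv.symm_apply_eq]; rfl
    simp [G, this]
  refine ⟨‖G.toContinuousLinearMap‖ + 1, by positivity, fun v => ?_⟩
  calc ‖B v‖ = ‖G.toContinuousLinearMap (A.rangeRestrict v)‖ := by rw [← hG v]; rfl
    _ ≤ ‖G.toContinuousLinearMap‖ * ‖A.rangeRestrict v‖ := ContinuousLinearMap.le_opNorm _ _
    _ ≤ (‖G.toContinuousLinearMap‖ + 1) * ‖A v‖ := by
      gcongr
      · linarith
      · exact le_rfl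

/-- Every function that does not vanish identically on `O` among the linear combinations of finitely
many holomorphic functions has a uniformly bounded number of zeros near a given point. -/
theorem exists_nhds_card_zeros_le {O : Set ℂ} (hO : IsOpen O) (hconn : IsPreconnected O)
    {ι : Type*} [Fintype ι] (c : ι → ℂ → ℂ) (hc : ∀ i, DifferentiableOn ℂ (c i) O)
    {x : ℂ} (hx : x ∈ O) :
    ∃ U ∈ 𝓝 x, ∃ ν : ℕ, ∀ l : ι → ℂ, (∀ t ∈ O, ∑ i, l i * c i t = 0) ∨
      ∀ S : Finset ℂ, ↑S ⊆ U → (∀ z ∈ S, ∑ i, l i * c i z = 0) → S.card ≤ ν := by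
  obtain ⟨ε, hε, hεO⟩ := nhds_basis_closedBall.mem_iff.1 (hO.mem_nhds hx)
  obtain ⟨r, rfl⟩ : ∃ r, ε = 4 * r := ⟨ε / 4, by ring⟩
  have hr : 0 < r := by linarith
  have hsub : closedBall x r ⊆ closedBall x (4 * r) := closedBall_subset_closedBall (by linarith)
  have hdiff (l : ι → ℂ) : DifferentiableOn ℂ (fun t => ∑ i, l i * c i t) O :=
    DifferentiableOn.fun_sum fun i _ => (hc i).const_mul (l i)
  let Φ (D : Set ℂ) (hD : D ⊆ O) : (ι → ℂ) →ₗ[ℂ] C(D, ℂ) :=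
    Fintype.linearCombination ℂ fun i => ⟨D.domRestrict (c i), ((hc i).continuousOn.mono hD).domRestrict⟩
  have hΦ (D : Set ℂ) (hD : D ⊆ O) (l : ι → ℂ) (t : D) : Φ D hD l t = ∑ i, l i * c i t := by
    simp only [Φ, Fintype.linearCombination_apply, ContinuousMap.sum_apply,
      ContinuousMap.smul_apply, smul_eq_mul]
    rfl
  have hid (l : ι → ℂ) (h : Φ _ (hsub.trans hεO) l = 0) : ∀ t ∈ O, ∑ i, l i * c i t = 0 := by
    refine (hdiff l).analyticOnNhd hO |>.eqOn_zero_of_preconnected_of_eventuallyEq_zero hconn hx ?_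
    filter_upwards [closedBall_mem_nhds x hr] with t ht
    rw [← hΦ _ (hsub.trans hεO) l ⟨t, ht⟩, h]
    rfl
  obtain ⟨C, hC, hAB⟩ := LinearMap.exists_norm_le_mul_norm_of_ker_le
    (Φ _ (hsub.trans hεO)) (Φ _ hεO) fun l hl => by
      ext t
      rw [hΦ _ hεO]
      exact hid l hl t (hεO t.2)
  obtain ⟨N, hN⟩ := exists_pow_lt_of_lt_one (inv_pos.2 hC) (by norm_num : (2 / 3 : ℝ) < 1)
  refine ⟨closedBall x r, closedBall_mem_nhds x hr, N, fun l => ?_⟩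
  by_contra! ⟨⟨t, htO, ht⟩, S, hS, hzero, hcard⟩
  refine ht (hid l ?_ t htO)
  set M := ‖Φ _ hεO l‖
  have hsmall : ‖Φ _ (hsub.trans hεO) l‖ ≤ (2 / 3) ^ S.card * M := by
    refine (ContinuousMap.norm_le _ (by positivity)).2 fun z => ?_
    rw [hΦ _ (hsub.trans hεO)]
    refine norm_le_pow_card_zeros_mul hO hr hεO S _ M (hdiff l) (fun w hw => ?_) hS hzero z z.2
    rw [← hΦ _ hεO l ⟨w, hw⟩]
    exact ContinuousMap.norm_coe_le_norm _ _
  have hpow : (2 / 3 : ℝ) ^ S.card ≤ (2 / 3) ^ N :=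
    pow_le_pow_of_le_one (by norm_num) (by norm_num) hcard.le
  have hlt : C * (2 / 3 : ℝ) ^ S.card < 1 := by
    rw [← mul_inv_cancel₀ hC.ne']
    gcongr
    exact hpow.trans_lt hN
  have hM : M ≤ C * (2 / 3 : ℝ) ^ S.card * M := by
    rw [mul_assoc]
    exact (hAB l).trans (by gcongr)
  have hM0 : M = 0 := by
    have : 0 ≤ M := norm_nonneg _
    nlinarith
  rw [hM0, mul_zero] at hsmall
  exact norm_le_zero_iff.1 hsmall

/-- The nonzero linear combinations of finitely many holomorphic functions on `O` have a uniformly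
bounded number of zeros in a compact subset of `O`. -/
theorem exists_card_zeros_le_of_isCompact {O : Set ℂ} (hO : IsOpen O) (hconn : IsPreconnected O)
    {ι : Type*} [Fintype ι] (c : ι → ℂ → ℂ) (hc : ∀ i, DifferentiableOn ℂ (c i) O)
    {K : Set ℂ} (hK : IsCompact K) (hKO : K ⊆ O) :
    ∃ ν : ℕ, ∀ l : ι → ℂ, (∀ t ∈ O, ∑ i, l i * c i t = 0) ∨
      ∀ S : Finset ℂ, ↑S ⊆ K → (∀ z ∈ S, ∑ i, l i * c i z = 0) → S.card ≤ ν := by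
  classical
  refine hK.induction_on (p := fun D => ∃ ν : ℕ, ∀ l : ι → ℂ, (∀ t ∈ O, ∑ i, l i * c i t = 0) ∨
      ∀ S : Finset ℂ, ↑S ⊆ D → (∀ z ∈ S, ∑ i, l i * c i z = 0) → S.card ≤ ν) ?_ ?_ ?_ ?_
  · exact ⟨0, fun l => .inr fun S hS _ => by simp_all⟩
  · rintro D D' hD ⟨ν, hν⟩
    exact ⟨ν, fun l => (hν l).imp_right fun h S hS => h S (hS.trans hD)⟩
  · rintro D D' ⟨ν, hν⟩ ⟨ν', hν'⟩
    refine ⟨ν + ν', fun l => ?_⟩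
    rcases hν l with h | h
    · exact .inl h
    rcases hν' l with h' | h'
    · exact .inl h'
    refine .inr fun S hS hzero => ?_
    rw [← Finset.card_filter_add_card_filter_not (s := S) (· ∈ D)]
    refine add_le_add (h _ ?_ fun z hz => hzero z (Finset.mem_filter.1 hz).1)
      (h' _ ?_ fun z hz => hzero z (Finset.mem_filter.1 hz).1)
    · intro z hz
      exact (Finset.mem_filter.1 hz).2
    · intro z hz
      obtain ⟨hzS, hzD⟩ := Finset.mem_filter.1 hz
      exact (hS hzS).resolve_left hzD
  · intro x hx
    obtain ⟨U, hU, hν⟩ := exists_nhds_card_zeros_le hO hconn c hc (hKO hx)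
    exact ⟨U, mem_nhdsWithin_of_mem_nhds hU, hν⟩

/-- The functions `ℂ → ℂ` that are holomorphic on `O`. -/
def holomorphicSubring (O : Set ℂ) : Subring (ℂ → ℂ) where
  carrier := {f | DifferentiableOn ℂ f O}
  mul_mem' hf hg := DifferentiableOn.mul hf hg
  one_mem' := differentiableOn_const 1
  add_mem' hf hg := DifferentiableOn.add hf hg
  zero_mem' := differentiableOn_const 0
  neg_mem' hf := DifferentiableOn.neg hf

/-- Evaluation at `(t, ξ)` of a polynomial in `ξ` with coefficients holomorphic in `t ∈ O`. -/
noncomputable def evalTXi (O : Set ℂ) {n : ℕ} (t : ℂ) (ξ : EuclideanSpace ℝ (Fin n)) :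
    MvPolynomial (Fin n) (holomorphicSubring O) →+* ℂ :=
  eval₂Hom ((Pi.evalRingHom (fun _ : ℂ => ℂ) t).comp (holomorphicSubring O).subtype)
    fun k => (ξ k : ℂ)

theorem evalTXi_C_mul_prod_X_pow {O : Set ℂ} {n : ℕ} (c : holomorphicSubring O) (e : Fin n → ℕ)
    (t : ℂ) (ξ : EuclideanSpace ℝ (Fin n)) :
    evalTXi O t ξ (C c * ∏ k, X k ^ e k) = (c : ℂ → ℂ) t * ((∏ k, ξ k ^ e k : ℝ) : ℂ) := by
  simp [evalTXi]

theorem evalTXi_eq_sum {O : Set ℂ} {n : ℕ} (s : MvPolynomial (Fin n) (holomorphicSubring O))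
    (t : ℂ) (ξ : EuclideanSpace ℝ (Fin n)) :
    evalTXi O t ξ s
      = ∑ m : s.support, (∏ k, (ξ k : ℂ) ^ (m : Fin n →₀ ℕ) k) *
          ((s.coeff m : holomorphicSubring O) : ℂ → ℂ) t := by
  rw [evalTXi, coe_eval₂Hom, eval₂_eq', ← Finset.sum_coe_sort]
  exact Finset.sum_congr rfl fun m _ => mul_comm _ _

theorem IsPolyXiAnalyticT.exists_evalTXi_eq {O : Set ℂ} {n : ℕ}
    {a : ℂ → EuclideanSpace ℝ (Fin n) → ℂ} (ha : IsPolyXiAnalyticT O n a) :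
    ∃ s : MvPolynomial (Fin n) (holomorphicSubring O), ∀ t ξ, evalTXi O t ξ s = a t ξ := by
  obtain ⟨d, e, c, hc, ha⟩ := ha
  refine ⟨∑ i, C ⟨c i, hc i⟩ * ∏ k, X k ^ e i k, fun t ξ => ?_⟩
  rw [map_sum, ha]
  exact Finset.sum_congr rfl fun i _ => evalTXi_C_mul_prod_X_pow _ _ _ _

/-- A function symmetric in two variables and polynomial in them is represented, after substituting
any two of three variables, by polynomials that permuting the variables permutes accordingly. -/
theorem IsPolyTauSigmaXiAnalyticT.exists_mvPolynomial {O : Set ℂ} {n : ℕ}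
    {Q : ℂ → ℂ → ℂ → EuclideanSpace ℝ (Fin n) → ℂ} (hQ : IsPolyTauSigmaXiAnalyticT O n Q)
    (hQsym : ∀ t τ σ ξ, Q t τ σ ξ = Q t σ τ ξ) (ι : Type*) :
    ∃ F : ι → ι → MvPolynomial ι (MvPolynomial (Fin n) (holomorphicSubring O)),
      (∀ j k, F j k = F k j) ∧
      (∀ (σ : Equiv.Perm ι) j k, rename σ (F j k) = F (σ j) (σ k)) ∧
      ∀ t ξ x j k, eval₂ (evalTXi O t ξ) x (F j k) = Q t (x j) (x k) ξ := by
  obtain ⟨d, p, q, e, c, hc, hQ⟩ := hQ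
  let b (i : Fin d) : MvPolynomial (Fin n) (holomorphicSubring O) :=
    C ⟨fun t => c i t / 2, (hc i).div_const 2⟩ * ∏ k, X k ^ e i k
  refine ⟨fun j k => ∑ i, C (b i) * (X j ^ p i * X k ^ q i + X k ^ p i * X j ^ q i),
    fun j k => ?_, fun σ j k => ?_, fun t ξ x j k => ?_⟩
  · exact Finset.sum_congr rfl fun i _ => by rw [add_comm]
  · simp
  · have hhalf : Q t (x j) (x k) ξ = (Q t (x j) (x k) ξ + Q t (x k) (x j) ξ) / 2 := by
      rw [hQsym t (x k)]
      ring
    rw [hhalf, hQ, hQ, ← Finset.sum_add_distrib, Finset.sum_div, eval₂_sum]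
    refine Finset.sum_congr rfl fun i _ => ?_
    simp only [eval₂_mul, eval₂_add, eval₂_pow, eval₂_C, eval₂_X, b, evalTXi_C_mul_prod_X_pow]
    ring

/-- A symmetric polynomial in the roots is a polynomial in the coefficients. -/
theorem MvPolynomial.IsSymmetric.exists_eval₂_eq {A B : Type*} [CommRing A] [CommRing B] {n : ℕ}
    {p : MvPolynomial (Fin n) A} (hp : p.IsSymmetric) (b : Fin n → A) :
    ∃ s : A, ∀ (φ : A →+* B) (x : Fin n → B),
      (∀ i : Fin n, eval₂ φ x (esymm (Fin n) A (i + 1)) = φ (b i)) → eval₂ φ x p = φ s := by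
  obtain ⟨w, hw⟩ := esymmAlgHom_surjective (R := A) (σ := Fin n) (Fintype.card_fin n).le ⟨p, hp⟩
  replace hw : aeval (fun i : Fin n => esymm (Fin n) A (i + 1)) w = p := by
    rw [← esymmAlgHom_apply, hw]
  refine ⟨eval b w, fun φ x h => ?_⟩
  subst hw
  clear hp
  induction w using MvPolynomial.induction_on with
  | C a => simp
  | add p q hp hq => rw [map_add, eval₂_add, hp, hq, map_add, map_add]
  | mul_X p i hp => rw [map_mul, eval₂_mul, hp, aeval_X, h, map_mul, eval_X, map_mul]

theorem MvPolynomial.IsSymmetric.aeval_of_rename {A ι : Type*} [CommRing A]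
    {p : MvPolynomial ι A} (hp : p.IsSymmetric) (r : ι → MvPolynomial ι A)
    (hr : ∀ (σ : Equiv.Perm ι) i, rename σ (r i) = r (σ i)) : (aeval r p).IsSymmetric := by
  intro σ
  conv_rhs => rw [← hp σ, aeval_rename]
  rw [← AlgHom.comp_apply, comp_aeval]
  simp only [hr, Function.comp_def]

theorem MvPolynomial.esymm_fin_three_one (A : Type*) [CommRing A] :
    esymm (Fin 3) A 1 = X 0 + X 1 + X 2 := by
  rw [esymm_one, Fin.sum_univ_three]

theorem MvPolynomial.esymm_fin_three_two (A : Type*) [CommRing A] :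
    esymm (Fin 3) A 2 = X 0 * X 1 + X 0 * X 2 + X 1 * X 2 := by
  have h : Finset.powersetCard 2 (Finset.univ : Finset (Fin 3)) = {{0, 1}, {0, 2}, {1, 2}} := by
    decide
  rw [esymm, h]
  have h1 : ({0, 1} : Finset (Fin 3)) ∉ ({{0, 2}, {1, 2}} : Finset (Finset (Fin 3))) := by decide
  have h2 : ({0, 2} : Finset (Fin 3)) ∉ ({{1, 2}} : Finset (Finset (Fin 3))) := by decide
  rw [Finset.sum_insert h1, Finset.sum_insert h2, Finset.sum_singleton]
  simp [add_assoc]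

theorem MvPolynomial.esymm_fin_three_three (A : Type*) [CommRing A] :
    esymm (Fin 3) A 3 = X 0 * X 1 * X 2 := by
  have h : Finset.powersetCard 3 (Finset.univ : Finset (Fin 3)) = {Finset.univ} := by decide
  rw [esymm, h, Finset.sum_singleton, Fin.prod_univ_three]

/-- `f` vanishes identically on `O` or has at most `ν` zeros in `K`. -/
def ZeroOrFewZeros (O K : Set ℂ) (ν : ℕ) (f : ℂ → ℂ) : Prop :=
  (∀ t ∈ O, f t = 0) ∨ ∀ S : Finset ℂ, ↑S ⊆ K → (∀ z ∈ S, f z = 0) → S.card ≤ ν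

theorem exists_zeroOrFewZeros_evalTXi {O : Set ℂ} (hO : IsOpen O) (hconn : IsPreconnected O)
    {K : Set ℂ} (hK : IsCompact K) (hKO : K ⊆ O) {n : ℕ}
    (s : MvPolynomial (Fin n) (holomorphicSubring O)) :
    ∃ ν, ∀ ξ : EuclideanSpace ℝ (Fin n), ZeroOrFewZeros O K ν fun t => evalTXi O t ξ s := by
  obtain ⟨ν, hν⟩ := exists_card_zeros_le_of_isCompact hO hconn
    (fun m : s.support => ((s.coeff (m : Fin n →₀ ℕ) : holomorphicSubring O) : ℂ → ℂ)) (fun m => (s.coeff (m : Fin n →₀ ℕ)).prop) hK hKO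
  refine ⟨ν, fun ξ => ?_⟩
  simp only [ZeroOrFewZeros, evalTXi_eq_sum]
  exact hν _

/-- If the elementary symmetric functions of three holomorphic functions have few zeros, then so
does each of the three functions. -/
theorem ZeroOrFewZeros.of_esymm {O K : Set ℂ} (hO : IsOpen O) (hconn : IsPreconnected O)
    (hKO : K ⊆ O) {f g h e₁ e₂ e₃ : ℂ → ℂ} (hf : DifferentiableOn ℂ f O)
    (hg : DifferentiableOn ℂ g O) (hh : DifferentiableOn ℂ h O)
    (h₁ : ∀ t ∈ O, f t + g t + h t = e₁ t)
    (h₂ : ∀ t ∈ O, f t * g t + f t * h t + g t * h t = e₂ t)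
    (h₃ : ∀ t ∈ O, f t * g t * h t = e₃ t) {ν₁ ν₂ ν₃ : ℕ} (H₁ : ZeroOrFewZeros O K ν₁ e₁)
    (H₂ : ZeroOrFewZeros O K ν₂ e₂) (H₃ : ZeroOrFewZeros O K ν₃ e₃) :
    ZeroOrFewZeros O K (ν₁ + ν₂ + ν₃) f := by
  have key {f g : ℂ → ℂ} (hf : DifferentiableOn ℂ f O) (hg : DifferentiableOn ℂ g O)
      (hfg : ∀ t ∈ O, f t * g t = 0) : (∀ t ∈ O, f t = 0) ∨ ∀ t ∈ O, g t = 0 :=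
    (hf.analyticOnNhd hO).eq_zero_or_eq_zero_of_mul_eq_zero (hg.analyticOnNhd hO) hfg hconn
  by_cases hf0 : ∀ t ∈ O, f t = 0
  · exact .inl hf0
  refine .inr fun S hS hzero => ?_
  have hSO {z : ℂ} (hz : z ∈ S) : z ∈ O := hKO (hS hz)
  rcases H₃ with H₃ | H₃
  swap
  · have := H₃ S hS fun z hz => by rw [← h₃ z (hSO hz), hzero z hz]; ring
    omega
  have hgh : ∀ t ∈ O, g t * h t = 0 := (key hf (hg.mul hh) fun t ht => by
    rw [← H₃ t ht, ← h₃ t ht, Pi.mul_apply, mul_assoc]).resolve_left hf0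
  rcases H₂ with H₂ | H₂
  swap
  · have := H₂ S hS fun z hz => by rw [← h₂ z (hSO hz), hzero z hz, hgh z (hSO hz)]; ring
    omega
  have hsum : ∀ t ∈ O, g t + h t = 0 := (key hf (hg.add hh) fun t ht => by
    have := h₂ t ht
    rw [hgh t ht, H₂ t ht] at this
    rw [Pi.add_apply]
    linear_combination this).resolve_left hf0
  rcases H₁ with H₁ | H₁
  · refine absurd (fun t ht => ?_) hf0
    linear_combination h₁ t ht + H₁ t ht - hsum t ht
  · have := H₁ S hS fun z hz => by
      linear_combination -(h₁ z (hSO hz)) + hzero z hz + hsum z (hSO hz)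
    omega

/-- If the monic cubic `P(t,τ,ξ)` (coefficients polynomial in `ξ`, analytic in `t ∈ O`)
factors for every `|ξ| ≥ R` with roots `τ_j(·,ξ)` analytic on `O`, and `Q(t,τ,σ,ξ)` is a
polynomial in `(τ,σ,ξ)`, symmetric in `(τ,σ)`, with coefficients analytic in `t`, then for
every compact `K ⊆ O` there is `ν`, independent of `ξ`, such that for every `|ξ| ≥ R` and
every pair `(j,k) ∈ S2 = {(1,2),(2,3),(3,1)}`, the function `t ↦ Q(t,τ_j(t,ξ),τ_k(t,ξ),ξ)`
is identically zero on `O` or has at most `ν` zeros in `K`. -/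
theorem stmt_6 (O : Set ℂ) (hO : IsOpen O) (hOconn : IsConnected O)
    (n : ℕ) (hn : 1 ≤ n) (R : ℝ) (hR : 0 < R)
    (a1 a2 a3 : ℂ → EuclideanSpace ℝ (Fin n) → ℂ)
    (ha1 : IsPolyXiAnalyticT O n a1) (ha2 : IsPolyXiAnalyticT O n a2)
    (ha3 : IsPolyXiAnalyticT O n a3)
    (τ : Fin 3 → ℂ → EuclideanSpace ℝ (Fin n) → ℂ)
    (hτan : ∀ ξ : EuclideanSpace ℝ (Fin n), R ≤ ‖ξ‖ → ∀ j : Fin 3,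
      DifferentiableOn ℂ (fun t => τ j t ξ) O)
    (hfac : ∀ ξ : EuclideanSpace ℝ (Fin n), R ≤ ‖ξ‖ → ∀ t ∈ O, ∀ z : ℂ,
      z ^ 3 + a1 t ξ * z ^ 2 + a2 t ξ * z + a3 t ξ
        = (z - τ 0 t ξ) * (z - τ 1 t ξ) * (z - τ 2 t ξ))
    (Q : ℂ → ℂ → ℂ → EuclideanSpace ℝ (Fin n) → ℂ)
    (hQ : IsPolyTauSigmaXiAnalyticT O n Q)
    (hQsym : ∀ t τ' σ' ξ, Q t τ' σ' ξ = Q t σ' τ' ξ)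
    (K : Set ℂ) (hK : IsCompact K) (hKO : K ⊆ O) :
    ∃ ν : ℕ, ∀ ξ : EuclideanSpace ℝ (Fin n), R ≤ ‖ξ‖ → ∀ j k : Fin 3,
      ((j = 0 ∧ k = 1) ∨ (j = 1 ∧ k = 2) ∨ (j = 2 ∧ k = 0)) →
      (∀ t ∈ O, Q t (τ j t ξ) (τ k t ξ) ξ = 0) ∨
      (∀ S : Finset ℂ, ↑S ⊆ K → (∀ z ∈ S, Q z (τ j z ξ) (τ k z ξ) ξ = 0) → S.card ≤ ν) := by
  obtain ⟨s₁, hs₁⟩ := ha1.exists_evalTXi_eq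
  obtain ⟨s₂, hs₂⟩ := ha2.exists_evalTXi_eq
  obtain ⟨s₃, hs₃⟩ := ha3.exists_evalTXi_eq
  obtain ⟨F, hFsymm, hFrename, hFeval⟩ := hQ.exists_mvPolynomial hQsym (Fin 3)
  let r (m : Fin 3) := F (m + 1) (m + 2)
  have hr (σ : Equiv.Perm (Fin 3)) (m : Fin 3) : rename σ (r m) = r (σ m) := by
    have hσ : ∀ (σ : Equiv.Perm (Fin 3)) (m : Fin 3),
        (σ (m + 1) = σ m + 1 ∧ σ (m + 2) = σ m + 2) ∨
          (σ (m + 1) = σ m + 2 ∧ σ (m + 2) = σ m + 1) := by decide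
    rcases hσ σ m with ⟨h₁, h₂⟩ | ⟨h₁, h₂⟩
    · simp only [r, hFrename, h₁, h₂]
    · simp only [r, hFrename, h₁, h₂]
      exact hFsymm _ _
  have hfew (i : ℕ) : ∃ ν, ∀ ξ : EuclideanSpace ℝ (Fin n), R ≤ ‖ξ‖ → ∃ e : ℂ → ℂ,
      (∀ t ∈ O, eval₂ (evalTXi O t ξ) (fun j => τ j t ξ)
        (aeval r (esymm (Fin 3) (MvPolynomial (Fin n) (holomorphicSubring O)) i)) = e t) ∧
      ZeroOrFewZeros O K ν e := by
    obtain ⟨s, hs⟩ := ((esymm_isSymmetric (Fin 3) _ i).aeval_of_rename r hr).exists_eval₂_eq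
      (B := ℂ) ![-s₁, s₂, -s₃]
    obtain ⟨ν, hν⟩ := exists_zeroOrFewZeros_evalTXi hO hOconn.isPreconnected hK hKO s
    refine ⟨ν, fun ξ hξ => ⟨_, fun t ht => hs _ _ fun m => ?_, hν ξ⟩⟩
    have h0 := hfac ξ hξ t ht 0
    have h1 := hfac ξ hξ t ht 1
    have h2 := hfac ξ hξ t ht (-1)
    fin_cases m
    · simp [esymm_fin_three_one, -esymm_one, hs₁]
      linear_combination -h0 + h1 / 2 + h2 / 2
    · simp [esymm_fin_three_two, hs₂]
      linear_combination -h1 / 2 + h2 / 2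
    · simp [esymm_fin_three_three, hs₃]
      linear_combination h0
  obtain ⟨ν₁, hν₁⟩ := hfew 1
  obtain ⟨ν₂, hν₂⟩ := hfew 2
  obtain ⟨ν₃, hν₃⟩ := hfew 3
  simp only [esymm_fin_three_one, esymm_fin_three_two, esymm_fin_three_three, map_add, map_mul,
    aeval_X, eval₂_add, eval₂_mul, r, hFeval] at hν₁ hν₂ hν₃
  refine ⟨ν₁ + ν₂ + ν₃, fun ξ hξ => ?_⟩
  obtain ⟨e₁, he₁, H₁⟩ := hν₁ ξ hξ
  obtain ⟨e₂, he₂, H₂⟩ := hν₂ ξ hξ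
  obtain ⟨e₃, he₃, H₃⟩ := hν₃ ξ hξ
  have hdiff (j k : Fin 3) : DifferentiableOn ℂ (fun t => Q t (τ j t ξ) (τ k t ξ) ξ) O := by
    obtain ⟨d, p, q, e, c, hc, hQ⟩ := hQ
    simp only [hQ]
    exact DifferentiableOn.fun_sum fun i _ =>
      (((hc i).mul ((hτan ξ hξ j).pow _)).mul ((hτan ξ hξ k).pow _)).mul_const _
  rintro j k (⟨rfl, rfl⟩ | ⟨rfl, rfl⟩ | ⟨rfl, rfl⟩)
  · refine ZeroOrFewZeros.of_esymm hO hOconn.isPreconnected hKO (hdiff 0 1) (hdiff 1 2) (hdiff 2 0)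
      (fun t ht => ?_) (fun t ht => ?_) (fun t ht => ?_) H₁ H₂ H₃
    · rw [← he₁ t ht]; simp; ring
    · rw [← he₂ t ht]; simp; ring
    · rw [← he₃ t ht]; simp; ring
  · refine ZeroOrFewZeros.of_esymm hO hOconn.isPreconnected hKO (hdiff 1 2) (hdiff 2 0) (hdiff 0 1)
      (fun t ht => ?_) (fun t ht => ?_) (fun t ht => ?_) H₁ H₂ H₃
    · rw [← he₁ t ht]; simp
    · rw [← he₂ t ht]; simp
    · rw [← he₃ t ht]; simp
  · refine ZeroOrFewZeros.of_esymm hO hOconn.isPreconnected hKO (hdiff 2 0) (hdiff 0 1) (hdiff 1 2)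
      (fun t ht => ?_) (fun t ht => ?_) (fun t ht => ?_) H₁ H₂ H₃
    · rw [← he₁ t ht]; simp; ring
    · rw [← he₂ t ht]; simp; ring
    · rw [← he₃ t ht]; simp; ring
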